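/- Assume Â_0 is symmetric positive definite, Â_k is symmetric positive semidefinite for k = 1, …, N, and Ŝ_k is symmetric positive definite for k = 0, …, N. Each matrix (−1)^{k+1}(I − Ŝ_k^{−1} S̃_k) has only real eigenvalues; let σ⁻ and σ⁺ be the minimum and maximum over k = 0, …, N of these eigenvalues. Let m be the largest even integer ≤ N+1 and m' the largest odd integer ≤ N+1. Then every eigenvalue λ of 𝒫̂_D^{−1}𝒜 is real and satisfies either −2cos(π/(2N+1)) + σ⁻ ≤ λ ≤ 2cos((m+1)π/(2m+1)) + σ⁺ or 2cos(m'π/(2m'+1)) + σ⁻ ≤ λ ≤ 2cos(π/(2N+3)) + σ⁺. -/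

import Mathlib

noncomputable section
open Matrix

/-- The symmetric block tridiagonal multiple saddle-point matrix `𝒜` with diagonal blocks
`(-1)^k A_k` (for `k = 0, …, N`) and sub-diagonal blocks `B_k` (here `B k` is the block
coupling levels `k` and `k+1`, i.e. the paper's `B_{k+1}`), super-diagonal blocks `B_kᵀ`. -/
def blockTri (N : ℕ) (n : ℕ → ℕ)
    (A : ∀ k : ℕ, Matrix (Fin (n k)) (Fin (n k)) ℝ)
    (B : ∀ k : ℕ, Matrix (Fin (n (k + 1))) (Fin (n k)) ℝ) :
    Matrix (Σ k : Fin (N + 1), Fin (n k.val)) (Σ k : Fin (N + 1), Fin (n k.val)) ℝ :=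
  fun p q =>
    if h : (p.1 : ℕ) = (q.1 : ℕ) then
      (-1 : ℝ) ^ (p.1 : ℕ) * A (p.1 : ℕ) p.2 (Fin.cast (congrArg n h.symm) q.2)
    else if h2 : (p.1 : ℕ) = (q.1 : ℕ) + 1 then
      B (q.1 : ℕ) (Fin.cast (congrArg n h2) p.2) q.2
    else if h3 : (q.1 : ℕ) = (p.1 : ℕ) + 1 then
      B (p.1 : ℕ) (Fin.cast (congrArg n h3) q.2) p.2
    else 0

lemma dotProduct_mulVec_comm_of_isHermitian {ι : Type*} [Fintype ι] {K : Matrix ι ι ℝ}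
    (hK : K.IsHermitian) (x y : ι → ℝ) : y ⬝ᵥ (K *ᵥ x) = x ⬝ᵥ (K *ᵥ y) := by
  rw [dotProduct_comm, dotProduct_mulVec, ← mulVec_transpose,
    ← conjTranspose_eq_transpose_of_trivial, hK.eq, dotProduct_comm]

/-- The spectral theorem for a real symmetric matrix, in the form of an orthogonal
diagonalization. -/
lemma exists_orthogonal_diagonalization {ι : Type*} [Fintype ι] [DecidableEq ι]
    {M : Matrix ι ι ℝ} (hM : M.IsHermitian) :
    ∃ V : Matrix ι ι ℝ, Vᵀ * V = 1 ∧ Vᵀ * M * V = diagonal hM.eigenvalues := by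
  have h := hM.conjStarAlgAut_star_eigenvectorUnitary
  rw [Unitary.conjStarAlgAut_star_apply] at h
  have h1 : star (hM.eigenvectorUnitary : Matrix ι ι ℝ) * hM.eigenvectorUnitary = 1 :=
    Unitary.coe_star_mul_self _
  rw [star_eq_conjTranspose, conjTranspose_eq_transpose_of_trivial] at h h1
  exact ⟨_, h1, h⟩

/-- Simultaneous diagonalization of a symmetric-definite pencil. -/
lemma exists_pencil_diagonalization {ι : Type*} [Fintype ι] [DecidableEq ι]
    {M P : Matrix ι ι ℝ} (hM : M.IsHermitian) (hP : P.PosDef) :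
    ∃ (Q : Matrix ι ι ℝ) (ev : ι → ℝ), IsUnit Q ∧ Qᵀ * P * Q = 1 ∧ Qᵀ * M * Q = diagonal ev := by
  obtain ⟨V, -, hVP⟩ := exists_orthogonal_diagonalization hP.isHermitian
  set D : Matrix ι ι ℝ := diagonal fun i => (√(hP.isHermitian.eigenvalues i))⁻¹ with hD
  have hK : (V * D)ᵀ * P * (V * D) = 1 := by
    calc (V * D)ᵀ * P * (V * D) = Dᵀ * (Vᵀ * P * V) * D := by
          simp only [transpose_mul, Matrix.mul_assoc]
      _ = 1 := by
          rw [hVP, hD, diagonal_transpose, diagonal_mul_diagonal, diagonal_mul_diagonal,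
            ← diagonal_one]
          congr 1
          ext i
          have hpos := hP.eigenvalues_pos i
          have hs := Real.sqrt_pos.2 hpos
          field_simp
          exact (Real.sq_sqrt hpos.le).symm
  have hH : ((V * D)ᵀ * M * (V * D)).IsHermitian := by
    simpa [conjTranspose_eq_transpose_of_trivial] using
      isHermitian_conjTranspose_mul_mul (V * D) hM
  obtain ⟨W, hW, hWM⟩ := exists_orthogonal_diagonalization hH
  have h1 : (V * D * W)ᵀ * P * (V * D * W) = 1 := by
    calc (V * D * W)ᵀ * P * (V * D * W) = Wᵀ * ((V * D)ᵀ * P * (V * D)) * W := by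
          rw [transpose_mul (V * D) W]
          simp only [Matrix.mul_assoc]
      _ = 1 := by rw [hK, Matrix.mul_one, hW]
  refine ⟨V * D * W, hH.eigenvalues, IsUnit.of_mul_eq_one_right _ h1, h1, ?_⟩
  rw [← hWM, transpose_mul (V * D) W]
  simp only [Matrix.mul_assoc]

lemma mulVec_col_of_pencil_diagonalization {ι : Type*} [Fintype ι] [DecidableEq ι]
    {M P Q : Matrix ι ι ℝ} {ev : ι → ℝ} (hQ : IsUnit Q) (hP : Qᵀ * P * Q = 1)
    (hM : Qᵀ * M * Q = diagonal ev) (i : ι) :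
    M *ᵥ (Q *ᵥ Pi.single i 1) = ev i • (P *ᵥ (Q *ᵥ Pi.single i 1)) := by
  have hQT : IsUnit Qᵀ := (isUnit_transpose Q).2 hQ
  have h : M * Q = P * Q * diagonal ev := by
    apply hQT.mul_left_cancel
    rw [← Matrix.mul_assoc, hM, ← Matrix.mul_assoc, ← Matrix.mul_assoc, hP, Matrix.one_mul]
  have hd : diagonal ev *ᵥ Pi.single i 1 = ev i • (Pi.single i 1 : ι → ℝ) := by
    ext j
    by_cases hj : j = i <;> simp [mulVec_diagonal, hj]
  rw [mulVec_mulVec, h, ← mulVec_mulVec, hd, mulVec_smul, mulVec_mulVec]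

lemma dotProduct_mulVec_of_diagonalization {ι : Type*} [Fintype ι] [DecidableEq ι]
    {M Q : Matrix ι ι ℝ} {ev : ι → ℝ} (hM : Qᵀ * M * Q = diagonal ev) (c d : ι → ℝ) :
    (Q *ᵥ c) ⬝ᵥ (M *ᵥ (Q *ᵥ d)) = ∑ i, ev i * (c i * d i) := by
  have : (Q *ᵥ c) ⬝ᵥ (M *ᵥ (Q *ᵥ d)) = c ⬝ᵥ ((Qᵀ * M * Q) *ᵥ d) := by
    rw [← mulVec_mulVec, ← mulVec_mulVec, dotProduct_mulVec c, vecMul_transpose]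
  rw [this, hM]
  simp only [dotProduct, mulVec_diagonal]
  exact Finset.sum_congr rfl fun i _ => by ring

/-- If all eigenvalues of a symmetric-definite pencil lie in `[a, b]`, so does its Rayleigh
quotient. -/
lemma rayleigh_bounds {ι : Type*} [Fintype ι] [DecidableEq ι]
    {M P : Matrix ι ι ℝ} (hM : M.IsHermitian) (hP : P.PosDef) {a b : ℝ}
    (h : ∀ (μ : ℝ) (w : ι → ℝ), w ≠ 0 → M *ᵥ w = μ • (P *ᵥ w) → a ≤ μ ∧ μ ≤ b) (x : ι → ℝ) :
    a * (x ⬝ᵥ (P *ᵥ x)) ≤ x ⬝ᵥ (M *ᵥ x) ∧ x ⬝ᵥ (M *ᵥ x) ≤ b * (x ⬝ᵥ (P *ᵥ x)) := by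
  obtain ⟨Q, ev, hQ, hQP, hQM⟩ := exists_pencil_diagonalization hM hP
  have hev : ∀ i, a ≤ ev i ∧ ev i ≤ b := fun i => by
    refine h _ (Q *ᵥ Pi.single i 1) (fun h0 => ?_)
      (mulVec_col_of_pencil_diagonalization hQ hQP hQM i)
    have := mulVec_injective_of_isUnit hQ (h0.trans (mulVec_zero Q).symm)
    simpa using congrFun this i
  obtain ⟨c, rfl⟩ := mulVec_surjective_iff_isUnit.2 hQ x
  rw [dotProduct_mulVec_of_diagonalization hQM,
    dotProduct_mulVec_of_diagonalization (hQP.trans diagonal_one.symm), Finset.mul_sum,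
    Finset.mul_sum]
  constructor <;> refine Finset.sum_le_sum fun i _ => ?_
  · nlinarith [mul_self_nonneg (c i), (hev i).1]
  · nlinarith [mul_self_nonneg (c i), (hev i).2]

/-- If no eigenvalue of a symmetric-definite pencil lies in `(b, c)`, every vector splits into
two parts on which the Rayleigh quotient is at least `c` and at most `b`, respectively. -/
lemma exists_spectral_splitting {ι : Type*} [Fintype ι] [DecidableEq ι]
    {M P : Matrix ι ι ℝ} (hM : M.IsHermitian) (hP : P.PosDef) {b c : ℝ}
    (h : ∀ (μ : ℝ) (w : ι → ℝ), w ≠ 0 → M *ᵥ w = μ • (P *ᵥ w) → μ ≤ b ∨ c ≤ μ) (x : ι → ℝ) :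
    ∃ y z : ι → ℝ, x = y + z ∧ c * (y ⬝ᵥ (P *ᵥ y)) ≤ y ⬝ᵥ (M *ᵥ y) ∧
      z ⬝ᵥ (M *ᵥ z) ≤ b * (z ⬝ᵥ (P *ᵥ z)) := by
  classical
  obtain ⟨Q, ev, hQ, hQP, hQM⟩ := exists_pencil_diagonalization hM hP
  have hev : ∀ i, ev i ≤ b ∨ c ≤ ev i := fun i => by
    refine h _ (Q *ᵥ Pi.single i 1) (fun h0 => ?_)
      (mulVec_col_of_pencil_diagonalization hQ hQP hQM i)
    have := mulVec_injective_of_isUnit hQ (h0.trans (mulVec_zero Q).symm)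
    simpa using congrFun this i
  obtain ⟨d, rfl⟩ := mulVec_surjective_iff_isUnit.2 hQ x
  refine ⟨Q *ᵥ fun i => if c ≤ ev i then d i else 0, Q *ᵥ fun i => if c ≤ ev i then 0 else d i,
    ?_, ?_, ?_⟩
  · rw [← mulVec_add]
    congr 1
    ext i
    by_cases hi : c ≤ ev i <;> simp [hi]
  all_goals
    rw [dotProduct_mulVec_of_diagonalization hQM,
      dotProduct_mulVec_of_diagonalization (hQP.trans diagonal_one.symm), Finset.mul_sum]
    refine Finset.sum_le_sum fun i _ => ?_
    by_cases hi : c ≤ ev i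
    · simp only [hi, if_true]
      nlinarith [mul_self_nonneg (d i)]
    · simp only [hi, if_false]
      nlinarith [mul_self_nonneg (d i), (hev i).resolve_right hi]

/-- Real-symmetric pencils with a positive definite right-hand side have real eigenvalues and
real eigenvectors. -/
lemma real_eigenpair_of_complex {ι : Type*} [Fintype ι] [DecidableEq ι]
    {M P : Matrix ι ι ℝ} (hM : M.IsHermitian) (hP : P.PosDef) {lam : ℂ} {v : ι → ℂ} (hv : v ≠ 0)
    (h : (M.map fun x : ℝ => (x : ℂ)) *ᵥ v = lam • ((P.map fun x : ℝ => (x : ℂ)) *ᵥ v)) :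
    ∃ (r : ℝ) (w : ι → ℝ), lam = (r : ℂ) ∧ w ≠ 0 ∧ M *ᵥ w = r • (P *ᵥ w) := by
  set x : ι → ℝ := fun i => (v i).re with hx
  set y : ι → ℝ := fun i => (v i).im with hy
  have hre : ∀ (K : Matrix ι ι ℝ) i, (((K.map fun x : ℝ => (x : ℂ)) *ᵥ v) i).re = (K *ᵥ x) i := by
    intro K i
    simp [mulVec, dotProduct, hx]
  have him : ∀ (K : Matrix ι ι ℝ) i, (((K.map fun x : ℝ => (x : ℂ)) *ᵥ v) i).im = (K *ᵥ y) i := by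
    intro K i
    simp [mulVec, dotProduct, hy]
  have h1 : M *ᵥ x = lam.re • (P *ᵥ x) - lam.im • (P *ᵥ y) := by
    ext i
    have := congrArg Complex.re (congrFun h i)
    simpa [hre, him, Complex.mul_re] using this
  have h2 : M *ᵥ y = lam.re • (P *ᵥ y) + lam.im • (P *ᵥ x) := by
    ext i
    have := congrArg Complex.im (congrFun h i)
    simpa [hre, him, Complex.mul_im] using this
  have h3 := dotProduct_mulVec_comm_of_isHermitian hM x y
  rw [h1, h2] at h3
  simp only [dotProduct_sub, dotProduct_add, dotProduct_smul, smul_eq_mul,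
    dotProduct_mulVec_comm_of_isHermitian hP.isHermitian x y] at h3
  have hxy : x ≠ 0 ∨ y ≠ 0 := by
    by_contra! h0
    exact hv (funext fun i => Complex.ext (congrFun h0.1 i) (congrFun h0.2 i))
  have hnn : ∀ u : ι → ℝ, 0 ≤ u ⬝ᵥ (P *ᵥ u) := fun u => hP.posSemidef.dotProduct_mulVec_nonneg u
  have hpos : ∀ u : ι → ℝ, u ≠ 0 → 0 < u ⬝ᵥ (P *ᵥ u) := fun u hu => hP.dotProduct_mulVec_pos hu
  have him0 : lam.im = 0 := by
    have h4 : lam.im * (x ⬝ᵥ (P *ᵥ x) + y ⬝ᵥ (P *ᵥ y)) = 0 := by linarith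
    refine (mul_eq_zero.1 h4).resolve_right (ne_of_gt ?_)
    rcases hxy with hu | hu
    · linarith [hpos x hu, hnn y]
    · linarith [hpos y hu, hnn x]
  rw [him0, zero_smul] at h1 h2
  rcases hxy with hu | hu
  · exact ⟨lam.re, x, Complex.ext rfl him0, hu, by simpa using h1⟩
  · exact ⟨lam.re, y, Complex.ext rfl him0, hu, by simpa using h2⟩

/-- Sequences of sector bounds that exclude `μ` from the spectrum of a block tridiagonal pencil
with `N + 1` levels. -/
structure IsSectorSeq (N : ℕ) (μ : ℝ) (lo hi : ℕ → ℝ) : Prop where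
  le : ∀ k ≤ N, lo k ≤ hi k
  mul_pos : ∀ k ≤ N, 0 < lo k * hi k
  lo_zero : lo 0 ≤ 1 - μ
  hi_zero : 1 - μ ≤ hi 0
  lo_succ_le : ∀ k < N, lo (k + 1) ≤ (-1) ^ (k + 1) - μ
  lo_succ_le_inv : ∀ k < N, lo (k + 1) ≤ -μ - 1 / lo k
  le_hi_succ : ∀ k < N, (-1) ^ (k + 1) - μ ≤ hi (k + 1)
  inv_le_hi_succ : ∀ k < N, -μ - 1 / hi k ≤ hi (k + 1)

lemma neg_one_pow_mem_Icc (k : ℕ) : (-1 : ℝ) ≤ (-1) ^ k ∧ (-1 : ℝ) ^ k ≤ 1 := by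
  rcases neg_one_pow_eq_or ℝ k with h | h <;> rw [h] <;> norm_num

lemma two_cos_mul_cos_odd (θ : ℝ) (k : ℕ) :
    2 * Real.cos θ * Real.cos ((2 * ((k + 1 : ℕ) : ℝ) + 1) * θ / 2)
      = Real.cos ((2 * ((k + 2 : ℕ) : ℝ) + 1) * θ / 2) + Real.cos ((2 * (k : ℝ) + 1) * θ / 2) := by
  have h1 : (2 * ((k + 2 : ℕ) : ℝ) + 1) * θ / 2 = (2 * ((k + 1 : ℕ) : ℝ) + 1) * θ / 2 + θ := by
    push_cast; ring
  have h2 : (2 * (k : ℝ) + 1) * θ / 2 = (2 * ((k + 1 : ℕ) : ℝ) + 1) * θ / 2 - θ := by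
    push_cast; ring
  rw [h1, h2, Real.cos_add, Real.cos_sub]
  ring

lemma two_cos_mul_cos_half (θ : ℝ) :
    2 * Real.cos θ * Real.cos ((2 * ((0 : ℕ) : ℝ) + 1) * θ / 2)
      = Real.cos ((2 * ((1 : ℕ) : ℝ) + 1) * θ / 2) + Real.cos ((2 * ((0 : ℕ) : ℝ) + 1) * θ / 2) := by
  have h1 : (2 * ((1 : ℕ) : ℝ) + 1) * θ / 2 = θ / 2 + θ := by push_cast; ring
  have h2 : (2 * ((0 : ℕ) : ℝ) + 1) * θ / 2 = θ / 2 := by push_cast; ring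
  have h3 : Real.cos (θ / 2) = Real.cos θ * Real.cos (θ / 2) + Real.sin θ * Real.sin (θ / 2) := by
    rw [← Real.cos_sub]
    congr 1
    ring
  rw [h1, h2, Real.cos_add]
  linarith

/-- The continued fraction `T_{k+1} = d - 1 / T_k` started at `d - 1`, at the parameter
`d = 2 cos (π / (2 N + 3))` for which it first vanishes at index `N`. -/
lemma exists_cos_continued_fraction (N : ℕ) :
    ∃ T : ℕ → ℝ, T 0 = 2 * Real.cos (Real.pi / (2 * (N : ℝ) + 3)) - 1 ∧
      (∀ k < N, T (k + 1) = 2 * Real.cos (Real.pi / (2 * (N : ℝ) + 3)) - 1 / T k) ∧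
      (∀ k < N, 0 < T k) ∧ (∀ k ≤ N, 0 ≤ T k) ∧ ∀ k ≤ N, T k ≤ 1 := by
  set θ := Real.pi / (2 * (N : ℝ) + 3) with hθ
  have hN3 : (0 : ℝ) < 2 * (N : ℝ) + 3 := by positivity
  have hθpos : 0 < θ := div_pos Real.pi_pos hN3
  have hθN : (2 * (N : ℝ) + 3) * θ = Real.pi := by rw [hθ]; field_simp
  set C : ℕ → ℝ := fun k => Real.cos ((2 * (k : ℝ) + 1) * θ / 2) with hC
  have hCpos : ∀ k ≤ N, 0 < C k := fun k hk => by
    have hk' : (k : ℝ) ≤ N := Nat.cast_le.2 hk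
    refine Real.cos_pos_of_mem_Ioo ⟨?_, ?_⟩
    · have : 0 ≤ (2 * (k : ℝ) + 1) * θ / 2 := by positivity
      linarith [Real.pi_pos]
    · nlinarith
  have hCnn : ∀ k ≤ N + 1, 0 ≤ C k := fun k hk => by
    have hk' : (k : ℝ) ≤ N + 1 := by exact_mod_cast hk
    refine Real.cos_nonneg_of_mem_Icc ⟨?_, ?_⟩
    · have : 0 ≤ (2 * (k : ℝ) + 1) * θ / 2 := by positivity
      linarith [Real.pi_pos]
    · nlinarith
  have hCanti : ∀ k ≤ N, C (k + 1) ≤ C k := fun k hk => by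
    have hk' : (k : ℝ) ≤ N := Nat.cast_le.2 hk
    refine Real.cos_le_cos_of_nonneg_of_le_pi (by positivity) ?_ ?_
    · push_cast
      nlinarith [Real.pi_pos]
    · push_cast
      nlinarith
  refine ⟨fun k => C (k + 1) / C k, ?_, fun k hk => ?_, fun k hk => ?_, fun k hk => ?_,
    fun k hk => ?_⟩
  · have h := two_cos_mul_cos_half θ
    have h0 := hCpos 0 (Nat.zero_le _)
    rw [div_eq_iff h0.ne']
    simp only [hC] at h ⊢
    linarith
  · have h := two_cos_mul_cos_odd θ k
    have h0 := hCpos k hk.le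
    have h1 := hCpos (k + 1) hk
    change C (k + 1 + 1) / C (k + 1) = 2 * Real.cos θ - 1 / (C (k + 1) / C k)
    have h' : 2 * Real.cos θ * C (k + 1) = C (k + 1 + 1) + C k := h
    field_simp
    linarith
  · exact div_pos (hCpos (k + 1) hk) (hCpos k hk.le)
  · exact div_nonneg (hCnn (k + 1) (by omega)) (hCpos k hk).le
  · exact (div_le_one (hCpos k hk)).2 (hCanti k hk)

lemma exists_isSectorSeq_of_gt {N : ℕ} {μ : ℝ}
    (hμ : 2 * Real.cos (Real.pi / (2 * (N : ℝ) + 3)) < μ) :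
    ∃ lo hi, IsSectorSeq N μ lo hi := by
  obtain ⟨T, hT0, hTs, hTpos, hTnn, hT1⟩ := exists_cos_continued_fraction N
  set d := 2 * Real.cos (Real.pi / (2 * (N : ℝ) + 3)) with hd
  have hd1 : 0 ≤ d - 1 := hT0 ▸ hTnn 0 (Nat.zero_le _)
  refine ⟨fun _ => -(1 + μ), fun k => -(T k + (μ - d)), ?_, ?_, ?_, ?_, ?_, ?_, ?_, ?_⟩
  · intro k hk
    linarith [hT1 k hk]
  · intro k hk
    rw [neg_mul_neg]
    exact mul_pos (by linarith) (by linarith [hTnn k hk])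
  · linarith
  · rw [hT0]; linarith
  · intro k hk
    linarith [neg_one_pow_mem_Icc (k + 1)]
  · intro k hk
    have : 0 < 1 / (1 + μ) := one_div_pos.2 (by linarith)
    rw [div_neg]
    linarith
  · intro k hk
    have : 1 ≤ 1 / T k := (one_le_div (hTpos k hk)).2 (hT1 k hk.le)
    rw [hTs k hk]
    linarith [(neg_one_pow_mem_Icc (k + 1)).2]
  · intro k hk
    have : 1 / (T k + (μ - d)) ≤ 1 / T k :=
      one_div_le_one_div_of_le (hTpos k hk) (by linarith)
    rw [hTs k hk, div_neg]
    linarith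

lemma exists_isSectorSeq_of_lt {N : ℕ} (hN : 1 ≤ N) {μ : ℝ}
    (hμ : μ < -(2 * Real.cos (Real.pi / (2 * (N : ℝ) + 1)))) :
    ∃ lo hi, IsSectorSeq N μ lo hi := by
  obtain ⟨N, rfl⟩ := Nat.exists_eq_add_of_le' hN
  have hcast : 2 * ((N + 1 : ℕ) : ℝ) + 1 = 2 * (N : ℝ) + 3 := by push_cast; ring
  rw [hcast] at hμ
  obtain ⟨T, hT0, hTs, hTpos, hTnn, hT1⟩ := exists_cos_continued_fraction N
  set d := 2 * Real.cos (Real.pi / (2 * (N : ℝ) + 3)) with hd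
  have hd1 : 0 ≤ d - 1 := hT0 ▸ hTnn 0 (Nat.zero_le _)
  refine ⟨fun k => Nat.casesOn k (1 - μ) fun j => T j + (-μ - d), fun _ => 1 - μ,
    ?_, ?_, ?_, ?_, ?_, ?_, ?_, ?_⟩
  · rintro (_ | k) hk
    · exact le_rfl
    · change T k + (-μ - d) ≤ 1 - μ
      linarith [hT1 k (by omega)]
  · rintro (_ | k) hk
    · have h : 0 < 1 - μ := by linarith
      exact mul_pos h h
    · exact mul_pos (by linarith [hTnn k (by omega)]) (by linarith)
  · exact le_rfl
  · exact le_rfl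
  · rintro (_ | k) hk
    · change T 0 + (-μ - d) ≤ _
      rw [hT0]
      norm_num
      linarith
    · change T (k + 1) + (-μ - d) ≤ _
      have hk' : k < N := by omega
      have : 1 ≤ 1 / T k := (one_le_div (hTpos k hk')).2 (hT1 k hk'.le)
      rw [hTs k hk']
      linarith [(neg_one_pow_mem_Icc (k + 1 + 1)).1]
  · rintro (_ | k) hk
    · change T 0 + (-μ - d) ≤ -μ - 1 / (1 - μ)
      have : 1 / (1 - μ) ≤ 1 := (div_le_one (by linarith)).2 (by linarith)
      rw [hT0]
      linarith
    · change T (k + 1) + (-μ - d) ≤ -μ - 1 / (T k + (-μ - d))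
      have hk' : k < N := by omega
      have : 1 / (T k + (-μ - d)) ≤ 1 / T k :=
        one_div_le_one_div_of_le (hTpos k hk') (by linarith)
      rw [hTs k hk']
      linarith
  · intro k hk
    linarith [(neg_one_pow_mem_Icc (k + 1)).2]
  · intro k hk
    have : 0 < 1 / (1 - μ) := one_div_pos.2 (by linarith)
    linarith

lemma cos_sign_pattern {N : ℕ} {ψ : ℝ} (h0 : 0 ≤ ψ) (hpi : ψ ≤ Real.pi)
    (hodd : ∀ k ≤ N, Odd k → (k : ℝ) * Real.pi < (2 * k + 1) * ψ)
    (heven : ∀ k ≤ N, Even k → (2 * k + 1) * ψ < ((k : ℝ) + 1) * Real.pi) :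
    (∀ j, 2 * j ≤ N → 0 < (-1) ^ j * Real.cos ((2 * ((2 * j : ℕ) : ℝ) + 1) * ψ / 2)) ∧
      ∀ j, 2 * j + 1 ≤ N →
        0 < -((-1) ^ j * Real.cos ((2 * ((2 * j + 1 : ℕ) : ℝ) + 1) * ψ / 2)) := by
  have hsq : ∀ j : ℕ, (-1 : ℝ) ^ j * (-1) ^ j = 1 := fun j => by rw [← mul_pow]; norm_num
  constructor
  · intro j hj
    have h1 := heven (2 * j) hj (even_two_mul j)
    have h2 : -Real.pi < (4 * j + 1) * ψ - 2 * j * Real.pi := by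
      rcases j with _ | j
      · push_cast
        linarith [Real.pi_pos]
      · have := hodd (2 * j + 1) (by omega) (odd_two_mul_add_one j)
        push_cast at this ⊢
        nlinarith
    set x := (2 * ((2 * j : ℕ) : ℝ) + 1) * ψ / 2 - j * Real.pi with hx
    have hxe : (2 * ((2 * j : ℕ) : ℝ) + 1) * ψ / 2 = x + j * Real.pi := by rw [hx]; ring
    rw [hxe, Real.cos_add_nat_mul_pi, ← mul_assoc, hsq, one_mul]
    push_cast at hx h1
    exact Real.cos_pos_of_mem_Ioo ⟨by linarith, by linarith⟩
  · intro j hj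
    have h1 := heven (2 * j) (by omega) (even_two_mul j)
    have h2 := hodd (2 * j + 1) hj (odd_two_mul_add_one j)
    set x := (2 * ((2 * j + 1 : ℕ) : ℝ) + 1) * ψ / 2 - j * Real.pi - Real.pi / 2 with hx
    have hxe : (2 * ((2 * j + 1 : ℕ) : ℝ) + 1) * ψ / 2 = x + Real.pi / 2 + j * Real.pi := by
      rw [hx]; ring
    rw [hxe, Real.cos_add_nat_mul_pi, ← mul_assoc, hsq, one_mul, Real.cos_add_pi_div_two, neg_neg]
    push_cast at hx h1 h2
    exact Real.sin_pos_of_pos_of_lt_pi (by linarith) (by linarith)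

/-- A continued fraction with alternating signs is sandwiched as needed for the spectral gap. -/
lemma exists_isSectorSeq_of_alternating {N : ℕ} (hN : 1 ≤ N) {μ : ℝ} {R : ℕ → ℝ}
    (hR0 : R 0 = 1 - μ) (hRs : ∀ k < N, R (k + 1) = -μ - 1 / R k)
    (hsign : ∀ k ≤ N, 0 < (-1) ^ k * R k) : ∃ lo hi, IsSectorSeq N μ lo hi := by
  have hμ1 : μ < 1 := by
    have := hsign 0 (Nat.zero_le _)
    rw [hR0] at this
    linarith
  have hμ2 : -1 < μ := by
    have := hsign 1 hN
    rw [hRs 0 hN, hR0] at this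
    by_contra! hc
    have h1 : 1 / (1 - μ) ≤ 1 := (div_le_one (by linarith)).2 (by linarith)
    linarith
  have hinv1 : 0 ≤ μ → 1 ≤ 1 / (1 - μ) ∧ 1 / (1 + μ) ≤ 1 := fun h =>
    ⟨(one_le_div (by linarith)).2 (by linarith), (div_le_one (by linarith)).2 (by linarith)⟩
  have hinv2 : μ ≤ 0 → 1 / (1 - μ) ≤ 1 ∧ 1 ≤ 1 / (1 + μ) := fun h =>
    ⟨(div_le_one (by linarith)).2 (by linarith), (one_le_div (by linarith)).2 (by linarith)⟩
  have hflip : 1 / (-1 - μ) = -(1 / (1 + μ)) := by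
    rw [← div_neg]
    congr 1
    ring
  have hsgn : ∀ k, 0 < (-1 : ℝ) ^ k * ((-1) ^ k - μ) := fun k => by
    rcases neg_one_pow_eq_or ℝ k with h | h <;> rw [h] <;> linarith
  have hprod : ∀ k ≤ N, 0 < R k * ((-1) ^ k - μ) := fun k hk => by
    have h := mul_pos (hsign k hk) (hsgn k)
    rcases neg_one_pow_eq_or ℝ k with e | e <;> rw [e] at h ⊢ <;> linarith
  rcases le_total 0 μ with hμ | hμ
  · have hle : ∀ k ≤ N, R k ≤ (-1) ^ k - μ := by
      intro k
      induction k with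
      | zero => intro _; simp [hR0]
      | succ k ih =>
        intro hk
        have ih := ih (by omega)
        have hs := hsign k (by omega)
        rw [hRs k hk, pow_succ]
        rcases neg_one_pow_eq_or ℝ k with h | h <;> rw [h] at ih hs ⊢
        · have : 1 ≤ 1 / R k := (one_le_div (by linarith)).2 (by linarith)
          linarith
        · have : 1 / (-R k) ≤ 1 := (div_le_one (by linarith)).2 (by linarith)
          rw [div_neg] at this
          linarith
    refine ⟨R, fun k => (-1) ^ k - μ, hle, hprod, hR0.le, by simp, fun k hk => hle _ hk,
      fun k hk => (hRs k hk).le, fun k _ => le_rfl, fun k _ => ?_⟩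
    have := hinv1 hμ
    simp only [pow_succ]
    rcases neg_one_pow_eq_or ℝ k with h | h <;> rw [h]
    · linarith
    · rw [hflip]
      linarith
  · have hle : ∀ k ≤ N, (-1) ^ k - μ ≤ R k := by
      intro k
      induction k with
      | zero => intro _; simp [hR0]
      | succ k ih =>
        intro hk
        have ih := ih (by omega)
        have hs := hsign k (by omega)
        rw [hRs k hk, pow_succ]
        rcases neg_one_pow_eq_or ℝ k with h | h <;> rw [h] at ih hs ⊢
        · have : 1 / R k ≤ 1 := (div_le_one (by linarith)).2 (by linarith)
          linarith
        · have : 1 ≤ 1 / (-R k) := (one_le_div (by linarith)).2 (by linarith)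
          rw [div_neg] at this
          linarith
    refine ⟨fun k => (-1) ^ k - μ, R, hle, fun k hk => mul_comm (R k) _ ▸ hprod k hk, by simp,
      hR0.ge, fun k _ => le_rfl, fun k _ => ?_, fun k hk => hle _ hk, fun k hk => (hRs k hk).ge⟩
    have := hinv2 hμ
    simp only [pow_succ]
    rcases neg_one_pow_eq_or ℝ k with h | h <;> rw [h]
    · linarith
    · rw [hflip]
      linarith

lemma exists_isSectorSeq_of_mem_gap {N : ℕ} (hN : 1 ≤ N) {μ : ℝ}
    (hodd : ∀ k ≤ N + 1, Odd k → μ < 2 * Real.cos ((k : ℝ) * Real.pi / (2 * k + 1)))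
    (heven : ∀ k ≤ N + 1, Even k → 2 * Real.cos (((k : ℝ) + 1) * Real.pi / (2 * k + 1)) < μ) :
    ∃ lo hi, IsSectorSeq N μ lo hi := by
  have h2 : μ / 2 ≤ 1 := by
    have := hodd 1 (by omega) odd_one
    linarith [Real.cos_le_one (((1 : ℕ) : ℝ) * Real.pi / (2 * (1 : ℕ) + 1))]
  have h2' : -1 ≤ μ / 2 := by
    have := heven 0 (by omega) Even.zero
    linarith [Real.neg_one_le_cos ((((0 : ℕ) : ℝ) + 1) * Real.pi / (2 * (0 : ℕ) + 1))]
  obtain ⟨ψ, hψ0, hψpi, rfl⟩ : ∃ ψ, 0 ≤ ψ ∧ ψ ≤ Real.pi ∧ μ = 2 * Real.cos ψ :=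
    ⟨Real.arccos (μ / 2), Real.arccos_nonneg _, Real.arccos_le_pi _, by
      rw [Real.cos_arccos h2' h2]; ring⟩
  have hpi := Real.pi_pos
  obtain ⟨he, ho⟩ := cos_sign_pattern (N := N + 1) hψ0 hψpi
    (fun k hk hk' => by
      by_contra! hc
      have hk0 : (0 : ℝ) < 2 * k + 1 := by positivity
      have h3 : ψ ≤ (k : ℝ) * Real.pi / (2 * k + 1) := (le_div_iff₀ hk0).2 (by linarith)
      have h4 : (k : ℝ) * Real.pi / (2 * k + 1) ≤ Real.pi := by
        rw [div_le_iff₀ hk0]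
        nlinarith [Nat.cast_nonneg (α := ℝ) k]
      linarith [hodd k hk hk', Real.cos_le_cos_of_nonneg_of_le_pi hψ0 h4 h3])
    (fun k hk hk' => by
      by_contra! hc
      have hk0 : (0 : ℝ) < 2 * k + 1 := by positivity
      have h3 : ((k : ℝ) + 1) * Real.pi / (2 * k + 1) ≤ ψ := (div_le_iff₀ hk0).2 (by linarith)
      linarith [heven k hk hk', Real.cos_le_cos_of_nonneg_of_le_pi (by positivity) hψpi h3])
  set C : ℕ → ℝ := fun k => Real.cos ((2 * (k : ℝ) + 1) * ψ / 2) with hC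
  have hCne : ∀ k ≤ N + 1, C k ≠ 0 := by
    intro k hk h0
    obtain ⟨j, rfl | rfl⟩ := Nat.even_or_odd' k
    · have := he j hk
      rw [show Real.cos _ = 0 from h0] at this
      simp at this
    · have := ho j hk
      rw [show Real.cos _ = 0 from h0] at this
      simp at this
  refine exists_isSectorSeq_of_alternating hN (R := fun k => -(C (k + 1) / C k)) ?_ ?_ ?_
  · have h := two_cos_mul_cos_half ψ
    have h0 := hCne 0 (Nat.zero_le _)
    change -(C 1 / C 0) = _
    have h' : 2 * Real.cos ψ * C 0 = C 1 + C 0 := h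
    field_simp
    linarith
  · intro k hk
    have h0 := hCne k (by omega)
    have h1 := hCne (k + 1) (by omega)
    have h' : 2 * Real.cos ψ * C (k + 1) = C (k + 1 + 1) + C k := two_cos_mul_cos_odd ψ k
    change -(C (k + 1 + 1) / C (k + 1)) = -(2 * Real.cos ψ) - 1 / -(C (k + 1) / C k)
    field_simp
    linarith
  · intro k hk
    obtain ⟨j, rfl | rfl⟩ := Nat.even_or_odd' k
    · have e1 : 0 < (-1) ^ j * C (2 * j) := he j (by omega)
      have e2 : 0 < -((-1) ^ j * C (2 * j + 1)) := ho j (by omega)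
      have := div_pos e2 e1
      rw [← mul_neg, mul_div_mul_left _ _ (pow_ne_zero j (by norm_num)), neg_div] at this
      simpa [pow_mul] using this
    · have e1 : 0 < -((-1) ^ j * C (2 * j + 1)) := ho j (by omega)
      have e2 : 0 < (-1) ^ (j + 1) * C (2 * j + 1 + 1) := he (j + 1) (by omega)
      have := div_pos e2 e1
      rw [pow_succ, mul_assoc, ← mul_neg, mul_div_mul_left _ _ (pow_ne_zero j (by norm_num)),
        neg_one_mul, neg_div_neg_eq] at this
      simpa [pow_succ, pow_mul] using this

/-- Numerical form of the statement that the ball with diameter `[b₀ r, a₀ r]` is contained in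
the ball with diameter `[b r, a r]`; here `rr`, `rv`, `vv` are the entries of a Gram matrix. -/
lemma sector_widen {a₀ b₀ a b rr rv vv : ℝ} (hrr : 0 ≤ rr)
    (hq : ∀ t : ℝ, 0 ≤ rr * (t * t) + (-2 * rv) * t + vv)
    (h : vv - (a₀ + b₀) * rv + a₀ * b₀ * rr ≤ 0) (hba : b₀ ≤ a₀) (ha : a₀ ≤ a) (hb : b ≤ b₀) :
    vv - (a + b) * rv + a * b * rr ≤ 0 := by
  have hcs := discrim_le_zero hq
  rw [discrim] at hcs
  have key : 0 ≤ rv - b₀ * rr ∧ 0 ≤ a₀ * rr - rv := by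
    rcases hba.lt_or_eq with hlt | rfl
    · have h1 := hq b₀
      have h2 := hq a₀
      constructor
      · by_contra! hc
        nlinarith [mul_pos (sub_pos.2 hlt) (neg_pos.2 hc)]
      · by_contra! hc
        nlinarith [mul_pos (sub_pos.2 hlt) (neg_pos.2 hc)]
    · have h0 : (rv - b₀ * rr) ^ 2 ≤ 0 := by nlinarith
      have h1 : rv - b₀ * rr = 0 := pow_eq_zero_iff two_ne_zero |>.1 (le_antisymm h0 (sq_nonneg _))
      constructor <;> linarith
  nlinarith [mul_nonneg (sub_nonneg.2 ha) key.1, mul_nonneg (sub_nonneg.2 hb) key.2,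
    mul_nonneg (mul_nonneg (sub_nonneg.2 hb) (sub_nonneg.2 ha)) hrr]

lemma sector_step_scalar {lo hi lo' hi' ε μ rr rv vv gg gw ww : ℝ} (hε : ε * ε = 1)
    (hlh : lo ≤ hi) (hpos : 0 < lo * hi) (hrr : 0 ≤ rr)
    (hq : ∀ t : ℝ, 0 ≤ rr * (t * t) + (-2 * rv) * t + vv)
    (hsec : rr - (lo + hi) * rv + lo * hi * vv ≤ 0)
    (hgw : gw = -(rv + ε * rr)) (hgg : gg ≤ vv + 2 * ε * rv + rr) (hww : rr ≤ ww)
    (h1 : lo' ≤ ε - μ) (h2 : lo' ≤ -μ - 1 / lo) (h3 : ε - μ ≤ hi') (h4 : -μ - 1 / hi ≤ hi') :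
    gg + (2 * (ε - μ) - lo' - hi') * gw + (ε - μ - lo') * (ε - μ - hi') * ww ≤ 0 := by
  have hlo : lo ≠ 0 := left_ne_zero_of_mul hpos.ne'
  have hhi : hi ≠ 0 := right_ne_zero_of_mul hpos.ne'
  have h0 : vv - (1 / lo + 1 / hi) * rv + 1 / lo * (1 / hi) * rr ≤ 0 := by
    have : vv - (1 / lo + 1 / hi) * rv + 1 / lo * (1 / hi) * rr
        = (rr - (lo + hi) * rv + lo * hi * vv) / (lo * hi) := by
      field_simp
      ring
    rw [this]
    exact div_nonpos_of_nonpos_of_nonneg hsec hpos.le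
  have hle : 1 / hi ≤ 1 / lo := by
    have : 1 / lo - 1 / hi = (hi - lo) / (lo * hi) := by field_simp
    have h5 : 0 ≤ (hi - lo) / (lo * hi) := div_nonneg (sub_nonneg.2 hlh) hpos.le
    linarith
  have hw := sector_widen (a := -μ - lo') (b := -μ - hi') hrr hq h0 hle (by linarith) (by linarith)
  have h6 : 0 ≤ (ε - μ - lo') * (hi' - (ε - μ)) * (ww - rr) :=
    mul_nonneg (mul_nonneg (by linarith) (by linarith)) (by linarith)
  have h7 : (ε * ε - 1) * rr = 0 := by rw [hε]; ring
  subst hgw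
  nlinarith

/-- `r` lies in the sector `[lo, hi]` of `v` for the quadratic form `S`, that is,
`⟨r - lo v, r - hi v⟩ ≤ 0`. -/
def InSector {ι : Type*} [Fintype ι] (S : Matrix ι ι ℝ) (lo hi : ℝ) (r v : ι → ℝ) : Prop :=
  r ⬝ᵥ (S *ᵥ r) - (lo + hi) * (r ⬝ᵥ (S *ᵥ v)) + lo * hi * (v ⬝ᵥ (S *ᵥ v)) ≤ 0

/-- Propagation of sector bounds through one step of block elimination. -/
lemma InSector.step {ι κ : Type*} [Fintype ι] [DecidableEq ι] [Fintype κ]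
    {S : Matrix ι ι ℝ} {S' : Matrix κ κ ℝ} {B : Matrix κ ι ℝ} (hS : S.PosDef) (hS' : S'.PosDef)
    (hpsd : (S' - B * S⁻¹ * Bᵀ).PosSemidef) {lo hi lo' hi' ε μ : ℝ} (hε : ε * ε = 1)
    (hlh : lo ≤ hi) (hpos : 0 < lo * hi)
    (h1 : lo' ≤ ε - μ) (h2 : lo' ≤ -μ - 1 / lo) (h3 : ε - μ ≤ hi') (h4 : -μ - 1 / hi ≤ hi')
    {r v : ι → ℝ} {r' w : κ → ℝ} (hr : S *ᵥ r = -(Bᵀ *ᵥ w))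
    (hr' : S' *ᵥ r' = B *ᵥ v + ε • ((S' - B * S⁻¹ * Bᵀ) *ᵥ w) - μ • (S' *ᵥ w))
    (hsec : InSector S lo hi r v) : InSector S' lo' hi' r' w := by
  have hdet : IsUnit S.det := (isUnit_iff_isUnit_det S).1 hS.isUnit
  have hinv : ∀ u, S⁻¹ *ᵥ (S *ᵥ u) = u := fun u => by
    rw [mulVec_mulVec, nonsing_inv_mul _ hdet, one_mulVec]
  have hinv' : ∀ u, S *ᵥ (S⁻¹ *ᵥ u) = u := fun u => by
    rw [mulVec_mulVec, mul_nonsing_inv _ hdet, one_mulVec]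
  have hadj : ∀ (x : κ → ℝ) (u : ι → ℝ), x ⬝ᵥ (B *ᵥ u) = (Bᵀ *ᵥ x) ⬝ᵥ u := fun x u => by
    rw [dotProduct_mulVec, mulVec_transpose]
  have hcomm := dotProduct_mulVec_comm_of_isHermitian hS.isHermitian
  have hcomm' := dotProduct_mulVec_comm_of_isHermitian hS'.isHermitian
  have hBt : Bᵀ *ᵥ w = -(S *ᵥ r) := by rw [hr, neg_neg]
  obtain ⟨g, rfl⟩ : ∃ g, r' = (ε - μ) • w + g := ⟨r' - (ε - μ) • w, by abel⟩
  have hg : S' *ᵥ g = B *ᵥ (v + ε • r) := by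
    have h5 : (B * S⁻¹ * Bᵀ) *ᵥ w = -(B *ᵥ r) := by
      rw [← mulVec_mulVec, hBt, ← mulVec_mulVec, mulVec_neg, hinv, mulVec_neg]
    rw [sub_mulVec, h5, mulVec_add, mulVec_smul, sub_smul] at hr'
    rw [mulVec_add, mulVec_smul]
    have := congrArg (fun u => u - (ε • S' *ᵥ w - μ • S' *ᵥ w)) hr'
    simp only [add_sub_cancel_left] at this
    rw [this, smul_sub, smul_neg]
    abel
  have hcontr : ∀ x : κ → ℝ, (Bᵀ *ᵥ x) ⬝ᵥ (S⁻¹ *ᵥ (Bᵀ *ᵥ x)) ≤ x ⬝ᵥ (S' *ᵥ x) := fun x => by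
    have h5 : 0 ≤ x ⬝ᵥ ((S' - B * S⁻¹ * Bᵀ) *ᵥ x) := hpsd.dotProduct_mulVec_nonneg x
    rw [sub_mulVec, dotProduct_sub, ← mulVec_mulVec, ← mulVec_mulVec, hadj] at h5
    linarith
  have hnn : ∀ u : ι → ℝ, 0 ≤ u ⬝ᵥ (S *ᵥ u) := fun u => hS.posSemidef.dotProduct_mulVec_nonneg u
  have hww : r ⬝ᵥ (S *ᵥ r) ≤ w ⬝ᵥ (S' *ᵥ w) := by
    have := hcontr w
    rw [hBt, mulVec_neg, hinv, neg_dotProduct_neg, dotProduct_comm] at this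
    exact this
  have hgw : w ⬝ᵥ (S' *ᵥ g) = -(r ⬝ᵥ (S *ᵥ v) + ε * (r ⬝ᵥ (S *ᵥ r))) := by
    rw [hg, hadj, hBt, neg_dotProduct, dotProduct_add, dotProduct_smul, smul_eq_mul,
      dotProduct_comm _ v, dotProduct_comm _ r, hcomm]
  have hgg : g ⬝ᵥ (S' *ᵥ g) ≤
      v ⬝ᵥ (S *ᵥ v) + 2 * ε * (r ⬝ᵥ (S *ᵥ v)) + r ⬝ᵥ (S *ᵥ r) := by
    set z := v + ε • r with hz
    set h := S⁻¹ *ᵥ (Bᵀ *ᵥ g) with hh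
    have e1 : g ⬝ᵥ (S' *ᵥ g) = z ⬝ᵥ (S *ᵥ h) := by
      rw [hg, hadj, hh, hinv', dotProduct_comm]
    have e2 : h ⬝ᵥ (S *ᵥ h) ≤ g ⬝ᵥ (S' *ᵥ g) := by
      have := hcontr g
      rwa [dotProduct_comm, ← hh, ← hinv' (Bᵀ *ᵥ g), ← hh] at this
    have e3 := hnn (z - h)
    rw [mulVec_sub, dotProduct_sub, sub_dotProduct, sub_dotProduct, hcomm z h] at e3
    have e4 : z ⬝ᵥ (S *ᵥ z) =
        v ⬝ᵥ (S *ᵥ v) + 2 * ε * (r ⬝ᵥ (S *ᵥ v)) + ε * ε * (r ⬝ᵥ (S *ᵥ r)) := by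
      rw [hz, mulVec_add, mulVec_smul, dotProduct_add, add_dotProduct, add_dotProduct]
      simp only [smul_dotProduct, dotProduct_smul, smul_eq_mul, hcomm r v]
      ring
    rw [hε, one_mul] at e4
    linarith
  have hq : ∀ t : ℝ, 0 ≤ r ⬝ᵥ (S *ᵥ r) * (t * t) + (-2 * (r ⬝ᵥ (S *ᵥ v))) * t
      + v ⬝ᵥ (S *ᵥ v) := fun t => by
    have e := hnn (v - t • r)
    rw [mulVec_sub, mulVec_smul, dotProduct_sub, sub_dotProduct, sub_dotProduct] at e
    simp only [smul_dotProduct, dotProduct_smul, smul_eq_mul, hcomm r v] at e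
    linarith
  have hfin := sector_step_scalar hε hlh hpos (hnn r) hq hsec hgw hgg hww h1 h2 h3 h4
  rw [InSector, mulVec_add, mulVec_smul]
  simp only [add_dotProduct, dotProduct_add, smul_dotProduct, dotProduct_smul, smul_eq_mul]
  rw [hcomm' w g]
  linarith

lemma eq_zero_of_inSector_zero {ι : Type*} [Fintype ι] {S : Matrix ι ι ℝ} (hS : S.PosDef)
    {lo hi : ℝ} (hpos : 0 < lo * hi) {v : ι → ℝ} (h : InSector S lo hi 0 v) : v = 0 := by
  by_contra hv
  have h1 : 0 < v ⬝ᵥ (S *ᵥ v) := hS.dotProduct_mulVec_pos hv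
  simp only [InSector, zero_dotProduct] at h
  nlinarith [mul_pos hpos h1]

/-- If the scalar sector recursion keeps a strict sign up to level `N`, then `μ` is not an
eigenvalue of the block tridiagonal pencil. -/
lemma block_eigenvector_eq_zero {N : ℕ} {n : ℕ → ℕ}
    {B : ∀ k : ℕ, Matrix (Fin (n (k + 1))) (Fin (n k)) ℝ}
    {S : ∀ k : ℕ, Matrix (Fin (n k)) (Fin (n k)) ℝ} (hS : ∀ k ≤ N, (S k).PosDef)
    (hpsd : ∀ k < N, (S (k + 1) - B k * (S k)⁻¹ * (B k)ᵀ).PosSemidef)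
    {μ : ℝ} {lo hi : ℕ → ℝ} (hseq : IsSectorSeq N μ lo hi)
    {V : ∀ k : ℕ, Fin (n k) → ℝ} (hV : V (N + 1) = 0)
    (hrow0 : S 0 *ᵥ V 0 + (B 0)ᵀ *ᵥ V 1 = μ • (S 0 *ᵥ V 0))
    (hrow : ∀ k < N, B k *ᵥ V k
      + (-1 : ℝ) ^ (k + 1) • ((S (k + 1) - B k * (S k)⁻¹ * (B k)ᵀ) *ᵥ V (k + 1))
      + (B (k + 1))ᵀ *ᵥ V (k + 2) = μ • (S (k + 1) *ᵥ V (k + 1))) :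
    ∀ k ≤ N, V k = 0 := by
  set r : ∀ k : ℕ, Fin (n k) → ℝ := fun k => -((S k)⁻¹ *ᵥ ((B k)ᵀ *ᵥ V (k + 1))) with hr
  have hdet : ∀ k ≤ N, IsUnit (S k).det := fun k hk =>
    (isUnit_iff_isUnit_det _).1 (hS k hk).isUnit
  have hSr : ∀ k ≤ N, S k *ᵥ r k = -((B k)ᵀ *ᵥ V (k + 1)) := fun k hk => by
    rw [hr, mulVec_neg, mulVec_mulVec, mul_nonsing_inv _ (hdet k hk), one_mulVec]
  have hsec : ∀ k ≤ N, InSector (S k) (lo k) (hi k) (r k) (V k) := by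
    intro k
    induction k with
    | zero =>
      intro hk
      have h0 : r 0 = (1 - μ) • V 0 := by
        have e : S 0 *ᵥ r 0 = S 0 *ᵥ ((1 - μ) • V 0) := by
          rw [hSr 0 hk, mulVec_smul, sub_smul, one_smul, ← hrow0]
          abel
        exact mulVec_injective_of_isUnit (hS 0 hk).isUnit e
      have hnn : 0 ≤ V 0 ⬝ᵥ (S 0 *ᵥ V 0) := (hS 0 hk).posSemidef.dotProduct_mulVec_nonneg _
      rw [InSector, h0, mulVec_smul]
      simp only [smul_dotProduct, dotProduct_smul, smul_eq_mul]
      nlinarith [mul_nonneg (mul_nonneg (sub_nonneg.2 hseq.lo_zero) (sub_nonneg.2 hseq.hi_zero)) hnn]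
    | succ k ih =>
      intro hk
      refine InSector.step (hS k (by omega)) (hS (k + 1) hk) (hpsd k hk) (ε := (-1) ^ (k + 1))
        (μ := μ) ?_ (hseq.le k (by omega)) (hseq.mul_pos k (by omega)) (hseq.lo_succ_le k hk)
        (hseq.lo_succ_le_inv k hk) (hseq.le_hi_succ k hk) (hseq.inv_le_hi_succ k hk)
        (hSr k (by omega)) ?_ (ih (by omega))
      · rw [← mul_pow]
        norm_num
      · rw [hSr (k + 1) hk, ← hrow k hk]
        abel
  have hback : ∀ j ≤ N, V (N + 1 - j) = 0 → V (N - j) = 0 := by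
    intro j hj h0
    have e : N + 1 - j = N - j + 1 := by omega
    rw [e] at h0
    have hr0 : r (N - j) = 0 := by simp [hr, h0]
    have := hsec (N - j) (by omega)
    rw [hr0] at this
    exact eq_zero_of_inSector_zero (hS _ (by omega)) (hseq.mul_pos _ (by omega)) this
  have hall : ∀ j ≤ N, V (N - j) = 0 := by
    intro j
    induction j with
    | zero => exact fun hj => hback 0 hj hV
    | succ j ih =>
      intro hj
      refine hback (j + 1) hj ?_
      have e : N + 1 - (j + 1) = N - j := by omega
      rw [e]
      exact ih (by omega)
  intro k hk
  have e : k = N - (N - k) := by omega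
  rw [e]
  exact hall _ (by omega)

lemma sum_range_tridiagonal {N k : ℕ} (hk : k < N + 1) (F : ℕ → ℝ) (hF : F (N + 1) = 0)
    (h : ∀ q, q ≠ k → k ≠ q + 1 → q ≠ k + 1 → F q = 0) :
    ∑ q ∈ Finset.range (N + 1), F q = (if k = 0 then 0 else F (k - 1)) + F k + F (k + 1) := by
  have e : ∀ q ∈ Finset.range (N + 1), F q =
      (if q + 1 = k then F q else 0) + (if q = k then F k else 0)
        + if q = k + 1 then F (k + 1) else 0 := by
    intro q _
    by_cases h1 : q = k
    · subst h1; simp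
    by_cases h2 : q = k + 1
    · subst h2; simp; omega
    by_cases h3 : q + 1 = k
    · simp [h1, h2, h3]
    · simp [h1, h2, h3, h q h1 (Ne.symm h3) h2]
  rw [Finset.sum_congr rfl e, Finset.sum_add_distrib, Finset.sum_add_distrib,
    Finset.sum_ite_eq', Finset.sum_ite_eq', if_pos (Finset.mem_range.2 hk)]
  congr 1
  · congr 1
    rcases k with _ | k
    · simp
    · simp only [add_left_inj, Finset.sum_ite_eq', Finset.mem_range]
      simp
      omega
  · by_cases h4 : k + 1 = N + 1
    · simp [h4, hF]
    · rw [if_pos (Finset.mem_range.2 (by omega))]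

/-- The `k`-th block of a stacked vector, extended by zero beyond level `N`. -/
def blockPart {N : ℕ} {n : ℕ → ℕ} (v : (Σ k : Fin (N + 1), Fin (n k.val)) → ℝ) (k : ℕ) :
    Fin (n k) → ℝ :=
  fun i => if h : k < N + 1 then v ⟨⟨k, h⟩, i⟩ else 0

lemma blockPart_succ_last {N : ℕ} {n : ℕ → ℕ} (v : (Σ k : Fin (N + 1), Fin (n k.val)) → ℝ) :
    blockPart v (N + 1) = 0 := by
  ext i
  simp [blockPart]

lemma eq_zero_of_blockPart {N : ℕ} {n : ℕ → ℕ} {v : (Σ k : Fin (N + 1), Fin (n k.val)) → ℝ}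
    (h : ∀ k ≤ N, blockPart v k = 0) : v = 0 := by
  ext ⟨⟨k, hk⟩, i⟩
  have := congrFun (h k (by omega)) i
  simpa [blockPart, hk] using this

lemma blockTri_mulVec {N : ℕ} {n : ℕ → ℕ} (A : ∀ k : ℕ, Matrix (Fin (n k)) (Fin (n k)) ℝ)
    (B : ∀ k : ℕ, Matrix (Fin (n (k + 1))) (Fin (n k)) ℝ)
    (v : (Σ k : Fin (N + 1), Fin (n k.val)) → ℝ) (k : ℕ) (hk : k < N + 1) (i : Fin (n k)) :
    (blockTri N n A B *ᵥ v) ⟨⟨k, hk⟩, i⟩ =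
      (match k, i with
        | 0, _ => 0
        | k + 1, i => (B k *ᵥ blockPart v k) i)
      + (-1) ^ k * (A k *ᵥ blockPart v k) i + ((B k)ᵀ *ᵥ blockPart v (k + 1)) i := by
  set F : ℕ → ℝ := fun q => ∑ j : Fin (n q),
    (if h : k = q then (-1 : ℝ) ^ k * A k i (Fin.cast (congrArg n h.symm) j)
      else if h2 : k = q + 1 then B q (Fin.cast (congrArg n h2) i) j
      else if h3 : q = k + 1 then B k (Fin.cast (congrArg n h3) j) i else 0) * blockPart v q j
    with hF
  have h1 : (blockTri N n A B *ᵥ v) ⟨⟨k, hk⟩, i⟩ = ∑ q ∈ Finset.range (N + 1), F q := by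
    rw [mulVec, dotProduct, Fintype.sum_sigma, ← Fin.sum_univ_eq_sum_range]
    refine Finset.sum_congr rfl fun q _ => Finset.sum_congr rfl fun j _ => ?_
    rw [blockPart, dif_pos q.2]
    rfl
  rw [h1, sum_range_tridiagonal hk F]
  · congr 1
    · congr 1
      · rcases k with _ | k
        · simp
        · simp [hF, mulVec, dotProduct]
      · simp [hF, mulVec, dotProduct, Finset.mul_sum, mul_assoc]
    · simp only [hF, mulVec, dotProduct]
      refine Finset.sum_congr rfl fun j _ => ?_
      rw [dif_neg (by omega), dif_neg (by omega), dif_pos trivial]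
      rfl
  · simp [hF, blockPart_succ_last]
  · intro q hq1 hq2 hq3
    simp [hF, Ne.symm hq1, hq2, hq3]

lemma blockDiagonal'_mulVec {N : ℕ} {n : ℕ → ℕ}
    (S : ∀ k : ℕ, Matrix (Fin (n k)) (Fin (n k)) ℝ)
    (v : (Σ k : Fin (N + 1), Fin (n k.val)) → ℝ) (k : ℕ) (hk : k < N + 1) (i : Fin (n k)) :
    (blockDiagonal' (fun k : Fin (N + 1) => S k) *ᵥ v) ⟨⟨k, hk⟩, i⟩ =
      (S k *ᵥ blockPart v k) i := by
  rw [mulVec, dotProduct, Fintype.sum_sigma, Finset.sum_eq_single ⟨k, hk⟩]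
  · refine Finset.sum_congr rfl fun j _ => ?_
    rw [blockDiagonal'_apply_eq]
    simp [blockPart, hk]
  · intro q _ hq
    refine Finset.sum_eq_zero fun j _ => ?_
    rw [blockDiagonal'_apply_ne _ _ _ (Ne.symm hq), zero_mul]
  · simp

lemma dotProduct_blockDiagonal'_mulVec {N : ℕ} {n : ℕ → ℕ}
    (S : ∀ k : ℕ, Matrix (Fin (n k)) (Fin (n k)) ℝ)
    (v : (Σ k : Fin (N + 1), Fin (n k.val)) → ℝ) :
    v ⬝ᵥ (blockDiagonal' (fun k : Fin (N + 1) => S k) *ᵥ v) =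
      ∑ k : Fin (N + 1), blockPart v k ⬝ᵥ (S k *ᵥ blockPart v k) := by
  rw [dotProduct, Fintype.sum_sigma]
  refine Finset.sum_congr rfl fun k _ => Finset.sum_congr rfl fun i _ => ?_
  rw [blockDiagonal'_mulVec S v k k.2 i, blockPart, dif_pos k.2]

lemma posDef_blockDiagonal' {N : ℕ} {n : ℕ → ℕ}
    {S : ∀ k : ℕ, Matrix (Fin (n k)) (Fin (n k)) ℝ} (hS : ∀ k ≤ N, (S k).PosDef) :
    (blockDiagonal' fun k : Fin (N + 1) => S k).PosDef := by
  refine PosDef.of_dotProduct_mulVec_pos ?_ fun v hv => ?_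
  · rw [IsHermitian, blockDiagonal'_conjTranspose]
    congr 1
    ext1 k
    exact (hS k (by omega)).isHermitian
  · rw [star_trivial, dotProduct_blockDiagonal'_mulVec]
    have hnn : ∀ k ∈ (Finset.univ : Finset (Fin (N + 1))),
        0 ≤ blockPart v k ⬝ᵥ (S k *ᵥ blockPart v k) := fun k _ =>
      (hS k (by omega)).posSemidef.dotProduct_mulVec_nonneg _
    refine lt_of_le_of_ne (Finset.sum_nonneg hnn) fun h0 => hv (eq_zero_of_blockPart fun k hk => ?_)
    by_contra hk0
    have h1 := (Finset.sum_eq_zero_iff_of_nonneg hnn).1 h0.symm ⟨k, by omega⟩ (Finset.mem_univ _)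
    exact absurd h1 ((hS k hk).dotProduct_mulVec_pos hk0).ne'

lemma isHermitian_blockTri {N : ℕ} {n : ℕ → ℕ} {A : ∀ k : ℕ, Matrix (Fin (n k)) (Fin (n k)) ℝ}
    {B : ∀ k : ℕ, Matrix (Fin (n (k + 1))) (Fin (n k)) ℝ} (hA : ∀ k ≤ N, (A k).IsHermitian) :
    (blockTri N n A B).IsHermitian := by
  ext ⟨⟨p, hp⟩, i⟩ ⟨⟨q, hq⟩, j⟩
  simp only [conjTranspose_apply, star_trivial, blockTri]
  by_cases h1 : p = q
  · subst h1
    have := (hA p (by omega)).apply i j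
    simpa using this
  · by_cases h2 : p = q + 1
    · subst h2
      simp
      intro h
      omega
    · by_cases h3 : q = p + 1
      · subst h3
        simp
        intro h
        omega
      · simp [h1, h2, h3, Ne.symm h1]

/-- Changing the diagonal blocks of `blockTri` amounts to adding a block diagonal matrix. -/
lemma blockTri_eq_add {N : ℕ} {n : ℕ → ℕ} (A A' : ∀ k : ℕ, Matrix (Fin (n k)) (Fin (n k)) ℝ)
    (B : ∀ k : ℕ, Matrix (Fin (n (k + 1))) (Fin (n k)) ℝ) :
    blockTri N n A B = blockTri N n A' B +
      blockDiagonal' fun k : Fin (N + 1) => (-1 : ℝ) ^ (k : ℕ) • (A k - A' k) := by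
  ext ⟨⟨p, hp⟩, i⟩ ⟨⟨q, hq⟩, j⟩
  rw [Matrix.add_apply]
  by_cases h1 : p = q
  · subst h1
    rw [blockDiagonal'_apply_eq]
    simp [blockTri]
    ring
  · rw [blockDiagonal'_apply_ne _ _ _ (by simpa using h1)]
    simp [blockTri, h1]

/-- Eigenvalues of a symmetric-definite pencil whose matrix is a perturbation of one with
eigenvalues in `[a, b] ∪ [c, d]`. -/
lemma eigenvalue_perturbation {ι : Type*} [Fintype ι] [DecidableEq ι] {M E P : Matrix ι ι ℝ}
    (hM : M.IsHermitian) (hE : E.IsHermitian) (hP : P.PosDef) {a b c d σm σp r : ℝ}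
    (hspec : ∀ (μ : ℝ) (w : ι → ℝ), w ≠ 0 → M *ᵥ w = μ • (P *ᵥ w) →
      (a ≤ μ ∧ μ ≤ d) ∧ (μ ≤ b ∨ c ≤ μ))
    (hσ : ∀ x : ι → ℝ, σm * (x ⬝ᵥ (P *ᵥ x)) ≤ x ⬝ᵥ (E *ᵥ x) ∧
      x ⬝ᵥ (E *ᵥ x) ≤ σp * (x ⬝ᵥ (P *ᵥ x)))
    {v : ι → ℝ} (hv : v ≠ 0) (h : (M + E) *ᵥ v = r • (P *ᵥ v)) :
    (a + σm ≤ r ∧ r ≤ b + σp) ∨ (c + σm ≤ r ∧ r ≤ d + σp) := by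
  have hpos : ∀ u : ι → ℝ, u ≠ 0 → 0 < u ⬝ᵥ (P *ᵥ u) := fun u hu => hP.dotProduct_mulVec_pos hu
  have hnn : ∀ u : ι → ℝ, 0 ≤ u ⬝ᵥ (P *ᵥ u) := fun u => hP.posSemidef.dotProduct_mulVec_nonneg u
  obtain ⟨h1, h2⟩ := rayleigh_bounds hM hP (fun μ w hw hw' => (hspec μ w hw hw').1) v
  obtain ⟨h3, h4⟩ := hσ v
  have h5 : v ⬝ᵥ (M *ᵥ v) + v ⬝ᵥ (E *ᵥ v) = r * (v ⬝ᵥ (P *ᵥ v)) := by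
    rw [← dotProduct_add, ← add_mulVec, h, dotProduct_smul, smul_eq_mul]
  have hvP := hpos v hv
  have hlow : a + σm ≤ r := le_of_mul_le_mul_right (by linarith) hvP
  have hupp : r ≤ d + σp := le_of_mul_le_mul_right (by linarith) hvP
  rcases le_or_gt r (b + σp) with hb | hb
  · exact Or.inl ⟨hlow, hb⟩
  rcases le_or_gt (c + σm) r with hc | hc
  · exact Or.inr ⟨hc, hupp⟩
  exfalso
  obtain ⟨y, z, rfl, hy, hz⟩ :=
    exists_spectral_splitting hM hP (fun μ w hw hw' => (hspec μ w hw hw').2) v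
  have hcr {K : Matrix ι ι ℝ} (hK : K.IsHermitian) (x y : ι → ℝ) :=
    dotProduct_mulVec_comm_of_isHermitian hK x y
  have e : (y - z) ⬝ᵥ ((M + E) *ᵥ (y + z)) = (y - z) ⬝ᵥ (r • (P *ᵥ (y + z))) := by rw [h]
  simp only [add_mulVec, mulVec_add, dotProduct_add, sub_dotProduct, dotProduct_smul,
    smul_eq_mul, hcr hM y z, hcr hE y z, hcr hP.isHermitian y z] at e
  have hEy := (hσ y).1
  have hEz := (hσ z).2
  have hyz : y ≠ 0 ∨ z ≠ 0 := by
    by_contra! h0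
    exact hv (by rw [h0.1, h0.2, add_zero])
  rcases hyz with hu | hu
  · nlinarith [mul_pos (sub_pos.2 hc) (hpos y hu), mul_nonneg (sub_pos.2 hb).le (hnn z)]
  · nlinarith [mul_nonneg (sub_pos.2 hc).le (hnn y), mul_pos (sub_pos.2 hb) (hpos z hu)]

lemma two_cos_gap_lower_le {k m : ℕ} (hkm : k ≤ m) :
    2 * Real.cos (((k : ℝ) + 1) * Real.pi / (2 * k + 1)) ≤
      2 * Real.cos (((m : ℝ) + 1) * Real.pi / (2 * m + 1)) := by
  have hkm' : (k : ℝ) ≤ m := Nat.cast_le.2 hkm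
  have hk0 := Nat.cast_nonneg (α := ℝ) k
  have hpi := Real.pi_pos
  refine mul_le_mul_of_nonneg_left (Real.cos_le_cos_of_nonneg_of_le_pi (by positivity) ?_ ?_)
    zero_le_two
  · rw [div_le_iff₀ (by positivity)]
    nlinarith
  · rw [div_le_div_iff₀ (by positivity) (by positivity)]
    nlinarith

lemma two_cos_gap_upper_le {k m : ℕ} (hkm : k ≤ m) :
    2 * Real.cos ((m : ℝ) * Real.pi / (2 * m + 1)) ≤
      2 * Real.cos ((k : ℝ) * Real.pi / (2 * k + 1)) := by
  have hkm' : (k : ℝ) ≤ m := Nat.cast_le.2 hkm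
  have hk0 := Nat.cast_nonneg (α := ℝ) k
  have hpi := Real.pi_pos
  refine mul_le_mul_of_nonneg_left (Real.cos_le_cos_of_nonneg_of_le_pi (by positivity) ?_ ?_)
    zero_le_two
  · rw [div_le_iff₀ (by positivity)]
    nlinarith
  · rw [div_le_div_iff₀ (by positivity) (by positivity)]
    nlinarith

/-- The eigenvalue inclusion set of the pencil preconditioned by its exact Schur complements. -/
lemma eigenvalue_mem_of_no_sectorSeq {N : ℕ} (hN : 1 ≤ N) {m m' : ℕ}
    (hm : m = if Even (N + 1) then N + 1 else N) (hm' : m' = if Odd (N + 1) then N + 1 else N)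
    {μ : ℝ} (h : ¬ ∃ lo hi, IsSectorSeq N μ lo hi) :
    (-(2 * Real.cos (Real.pi / (2 * (N : ℝ) + 1))) ≤ μ ∧
      μ ≤ 2 * Real.cos (Real.pi / (2 * (N : ℝ) + 3))) ∧
    (μ ≤ 2 * Real.cos (((m : ℝ) + 1) * Real.pi / (2 * (m : ℝ) + 1)) ∨
      2 * Real.cos ((m' : ℝ) * Real.pi / (2 * (m' : ℝ) + 1)) ≤ μ) := by
  refine ⟨⟨not_lt.1 fun hc => h (exists_isSectorSeq_of_lt hN hc),
    not_lt.1 fun hc => h (exists_isSectorSeq_of_gt hc)⟩, ?_⟩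
  by_contra! hc
  refine h (exists_isSectorSeq_of_mem_gap hN (fun k hk hk' => ?_) fun k hk hk' => ?_)
  · refine hc.2.trans_le (two_cos_gap_upper_le ?_)
    grind
  · refine (two_cos_gap_lower_le ?_).trans_lt hc.1
    grind

/-- Eigenvalue bounds for `c • (1 - S⁻¹ T)` bound the quadratic form of `c • (S - T)` relative
to that of `S`. -/
lemma dotProduct_mulVec_bounds_of_eigenvalue_bounds {ι : Type*} [Fintype ι] [DecidableEq ι]
    {S T : Matrix ι ι ℝ} (hS : S.PosDef) (hT : T.IsHermitian) {s σm σp : ℝ}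
    (h : ∀ μ : ℂ, (∃ w : ι → ℂ, w ≠ 0 ∧
      (((s • ((1 : Matrix ι ι ℝ) - S⁻¹ * T)).map (fun x : ℝ => (x : ℂ))).mulVec w = μ • w)) →
      ∃ r : ℝ, μ = (r : ℂ) ∧ σm ≤ r ∧ r ≤ σp) (x : ι → ℝ) :
    σm * (x ⬝ᵥ (S *ᵥ x)) ≤ x ⬝ᵥ ((s • (S - T)) *ᵥ x) ∧
      x ⬝ᵥ ((s • (S - T)) *ᵥ x) ≤ σp * (x ⬝ᵥ (S *ᵥ x)) := by
  refine rayleigh_bounds ((hS.isHermitian.sub hT).smul (IsSelfAdjoint.all s)) hS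
    (fun μ w hw hμ => ?_) x
  have hu : IsUnit S.det := hS.isUnit.map Matrix.detMonoidHom
  have key : (s • ((1 : Matrix ι ι ℝ) - S⁻¹ * T)) *ᵥ w = μ • w := by
    have h1 : s • ((1 : Matrix ι ι ℝ) - S⁻¹ * T) = S⁻¹ * (s • (S - T)) := by
      rw [Matrix.mul_smul, Matrix.mul_sub, nonsing_inv_mul S hu]
    rw [h1, ← mulVec_mulVec, hμ, mulVec_smul, mulVec_mulVec, nonsing_inv_mul S hu, one_mulVec]
  have hcast : (fun i => (w i : ℂ)) ≠ 0 := fun h0 =>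
    hw (funext fun i => Complex.ofReal_injective (congrFun h0 i))
  obtain ⟨r, hr, hlo, hhi⟩ := h μ ⟨_, hcast, by
    ext i
    have := congrArg (fun t : ℝ => (t : ℂ)) (congrFun key i)
    simpa [mulVec, dotProduct] using this⟩
  obtain rfl : μ = r := Complex.ofReal_injective hr
  exact ⟨hlo, hhi⟩

/-- perturbation bounds for the inexact block diagonal preconditioner.
Here `Sh k` are the approximate Schur complements `Ŝ_k`, `St k` the perturbed Schur
complements `S̃_k` (`S̃_0 = A_0`, `S̃_{i+1} = A_{i+1} + B_i Ŝ_i⁻¹ B_iᵀ`), `Ah k = Â_k`,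
and `σ⁻, σ⁺` bound the (real) eigenvalues of all `(-1)^{k+1}(I - Ŝ_k⁻¹ S̃_k)`.
Every eigenvalue `λ` of `𝒫̂_D⁻¹ 𝒜` is real and lies in the Minkowski sum
`ℐ_{N+1} + [σ⁻, σ⁺]`. -/
theorem stmt3 (N : ℕ) (hN : 1 ≤ N) (n : ℕ → ℕ) (hnN : 1 ≤ n N)
    (hmono : ∀ k < N, n (k + 1) ≤ n k)
    (A : ∀ k : ℕ, Matrix (Fin (n k)) (Fin (n k)) ℝ)
    (B : ∀ k : ℕ, Matrix (Fin (n (k + 1))) (Fin (n k)) ℝ)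
    (hA0 : (A 0).PosDef)
    (hA : ∀ k, 1 ≤ k → k ≤ N → (A k).PosSemidef)
    (hB : ∀ k < N, (B k).rank = n (k + 1))
    (Sh : ∀ k : ℕ, Matrix (Fin (n k)) (Fin (n k)) ℝ)
    (St : ∀ k : ℕ, Matrix (Fin (n k)) (Fin (n k)) ℝ)
    (hSt0 : St 0 = A 0)
    (hSt : ∀ i, St (i + 1) = A (i + 1) + B i * (Sh i)⁻¹ * (B i)ᵀ)
    (Ah : ∀ k : ℕ, Matrix (Fin (n k)) (Fin (n k)) ℝ)
    (hAh : ∀ k, Ah k = A k + Sh k - St k)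
    (hAh0 : (Ah 0).PosDef)
    (hAhk : ∀ k, 1 ≤ k → k ≤ N → (Ah k).PosSemidef)
    (hSh : ∀ k ≤ N, (Sh k).PosDef)
    (σm σp : ℝ)
    (hσ : ∀ k ≤ N, ∀ μ : ℂ,
      (∃ w : Fin (n k) → ℂ, w ≠ 0 ∧
        ((((-1 : ℝ)^(k + 1) • ((1 : Matrix (Fin (n k)) (Fin (n k)) ℝ) - (Sh k)⁻¹ * St k)).map
          (fun x : ℝ => (x : ℂ))).mulVec w = μ • w)) →
      ∃ r : ℝ, μ = (r : ℂ) ∧ σm ≤ r ∧ r ≤ σp)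
    (m m' : ℕ)
    (hm : m = if Even (N + 1) then N + 1 else N)
    (hm' : m' = if Odd (N + 1) then N + 1 else N)
    (lam : ℂ)
    (hlam : ∃ v : (Σ k : Fin (N + 1), Fin (n k.val)) → ℂ, v ≠ 0 ∧
      ((blockTri N n A B).map (fun x : ℝ => (x : ℂ))).mulVec v =
        lam • ((Matrix.blockDiagonal'
          (fun k : Fin (N + 1) => Sh (k : ℕ))).map (fun x : ℝ => (x : ℂ))).mulVec v) :
    ∃ r : ℝ, lam = (r : ℂ) ∧
      ((-(2 * Real.cos (Real.pi / (2 * (N : ℝ) + 1))) + σm ≤ r ∧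
          r ≤ 2 * Real.cos (((m : ℝ) + 1) * Real.pi / (2 * (m : ℝ) + 1)) + σp) ∨
        (2 * Real.cos ((m' : ℝ) * Real.pi / (2 * (m' : ℝ) + 1)) + σm ≤ r ∧
          r ≤ 2 * Real.cos (Real.pi / (2 * (N : ℝ) + 3)) + σp)) := by
  have hAherm : ∀ k ≤ N, (A k).IsHermitian := by
    rintro (_ | k) hk
    · exact hA0.isHermitian
    · exact (hA _ (by omega) hk).isHermitian
  have hAhherm : ∀ k ≤ N, (Ah k).IsHermitian := by
    rintro (_ | k) hk
    · exact hAh0.isHermitian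
    · exact (hAhk _ (by omega) hk).isHermitian
  have hStherm : ∀ k ≤ N, (St k).IsHermitian := by
    intro k hk
    have : St k = A k + Sh k - Ah k := by rw [hAh]; abel
    rw [this]
    exact ((hAherm k hk).add (hSh k hk).isHermitian).sub (hAhherm k hk)
  have hAh_zero : Ah 0 = Sh 0 := by rw [hAh, hSt0]; abel
  have hAh_succ : ∀ k, Ah (k + 1) = Sh (k + 1) - B k * (Sh k)⁻¹ * (B k)ᵀ := by
    intro k
    rw [hAh, hSt]
    abel
  have hP := posDef_blockDiagonal' hSh
  obtain ⟨v, hv, hlam⟩ := hlam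
  obtain ⟨r, w, hr, hw, hrw⟩ := real_eigenpair_of_complex (isHermitian_blockTri hAherm) hP hv hlam
  refine ⟨r, hr, ?_⟩
  have hE : (blockDiagonal' fun k : Fin (N + 1) =>
      (-1 : ℝ) ^ (k : ℕ) • (A k - Ah k)).IsHermitian := by
    rw [IsHermitian, blockDiagonal'_conjTranspose]
    congr 1
    ext1 k
    exact ((hAherm k (by omega)).sub (hAhherm k (by omega))).smul (IsSelfAdjoint.all _)
  rw [blockTri_eq_add A Ah B] at hrw
  refine eigenvalue_perturbation (isHermitian_blockTri hAhherm) hE hP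
    (fun μ u hu hμ => eigenvalue_mem_of_no_sectorSeq hN hm hm' ?_) (fun x => ?_) hw hrw
  · rintro ⟨lo, hi, hseq⟩
    have hrows (k : ℕ) (hk : k < N + 1) (i : Fin (n k)) := congrFun hμ ⟨⟨k, hk⟩, i⟩
    simp only [Pi.smul_apply, blockTri_mulVec, blockDiagonal'_mulVec Sh] at hrows
    refine hu (eq_zero_of_blockPart (block_eigenvector_eq_zero (B := B) hSh
      (fun k hk => ?_) hseq
      (blockPart_succ_last u) ?_ fun k hk => ?_))
    · exact hAh_succ k ▸ hAhk (k + 1) (by omega) hk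
    · ext i
      simpa [hAh_zero] using hrows 0 (by omega) i
    · ext i
      rw [← hAh_succ]
      exact hrows (k + 1) (by omega) i
  · have hblock (k : Fin (N + 1)) := dotProduct_mulVec_bounds_of_eigenvalue_bounds
      (hSh k (by omega)) (hStherm k (by omega)) (hσ k (by omega)) (blockPart x k)
    have hsign (k : ℕ) : (-1 : ℝ) ^ (k + 1) • (Sh k - St k) = (-1 : ℝ) ^ k • (A k - Ah k) := by
      rw [pow_succ, mul_smul, hAh]
      congr 1
      module
    simp only [hsign] at hblock
    rw [dotProduct_blockDiagonal'_mulVec Sh,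
      dotProduct_blockDiagonal'_mulVec fun k => (-1 : ℝ) ^ k • (A k - Ah k),
      Finset.mul_sum, Finset.mul_sum]
    exact ⟨Finset.sum_le_sum fun k _ => (hblock k).1, Finset.sum_le_sum fun k _ => (hblock k).2⟩
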